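/- arXiv:1412.3006 — 3 statements merged into one kernel-verified Lean document; each statement's English description precedes it below -/
import Mathlib

section
/- If C is a reduced homogeneous perfect code of length t and H is a Hamming code of length r, then the Mollard code M(C,H) (with zero function) is a homogeneous perfect code of length tr + t + r. -/
set_option linter.unusedSectionVars false

/-- Binary vectors of length `|ι|`, indexed by `ι`. -/
abbrev F (ι : Type*) : Type _ := ι → ZMod 2

section Defs

variable {ι : Type*}

/-- The support of a vector: the set of its nonzero coordinate positions. -/
def supp (x : F ι) : Set ι := {i | x i ≠ 0}

/-- Action of a permutation on binary vectors by permuting coordinates: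
`(permAct π x) (π i) = x i`. -/
def permAct (π : Equiv.Perm ι) (x : F ι) : F ι := x ∘ π.symm

/-- The image `π(C)` of a code under a coordinate permutation. -/
def permCode (π : Equiv.Perm ι) (C : Set (F ι)) : Set (F ι) := permAct π '' C

/-- The translateCode `y + C` of a code. -/
def translateCode (y : F ι) (C : Set (F ι)) : Set (F ι) := (y + ·) '' C

/-- `Sym(C) = {π : π(C) = C}`. -/
def SymSet (C : Set (F ι)) : Set (Equiv.Perm ι) := {π | permCode π C = C}

/-- `Rot(C) = {π : ∃ y ∈ C, y + π(C) = C}`. -/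
def RotSet (C : Set (F ι)) : Set (Equiv.Perm ι) :=
  {π | ∃ y ∈ C, translateCode y (permCode π C) = C}

/-- `Rot_y(C) = {π : y + π(C) = C}`. -/
def RotAt (C : Set (F ι)) (y : F ι) : Set (Equiv.Perm ι) :=
  {π | translateCode y (permCode π C) = C}

/-- `Tr(C) = {y ∈ C : ∃ π, y + π(C) = C}`. -/
def TrSet (C : Set (F ι)) : Set (F ι) :=
  {y | y ∈ C ∧ ∃ π : Equiv.Perm ι, translateCode y (permCode π C) = C}

/-- `Ker(C) = {x ∈ C : x + C = C}`. -/
def KerSet (C : Set (F ι)) : Set (F ι) := {x | x ∈ C ∧ translateCode x C = C}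

/-- `Aut(C) = {(y, π) : y + π(C) = C}`. -/
def AutSet (C : Set (F ι)) : Set (F ι × Equiv.Perm ι) :=
  {p | translateCode p.1 (permCode p.2 C) = C}

/-- A (reduced) code is transitive if for every codeword `y` there is a permutation `π`
with `y + π(C) = C`. -/
def IsTransitive (C : Set (F ι)) : Prop :=
  ∀ y ∈ C, ∃ π : Equiv.Perm ι, translateCode y (permCode π C) = C

/-- A code is propelinear if `Aut(C)` contains a subgroup acting regularly on `C`
(the group law is `(y, π) * (y', π') = (y + π(y'), π ∘ π')`, acting by `(y,π) • x = y + π(x)`). -/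
def IsPropelinear (C : Set (F ι)) : Prop :=
  ∃ A : Set (F ι × Equiv.Perm ι),
    (∀ a ∈ A, translateCode a.1 (permCode a.2 C) = C) ∧
    ((0, 1) ∈ A) ∧
    (∀ a ∈ A, ∀ b ∈ A, (a.1 + permAct a.2 b.1, a.2 * b.2) ∈ A) ∧
    (∀ a ∈ A, (permAct a.2⁻¹ a.1, a.2⁻¹) ∈ A) ∧
    (∀ c ∈ C, ∀ c' ∈ C, ∃! a, a ∈ A ∧ a.1 + permAct a.2 c = c')

variable [Fintype ι] [DecidableEq ι]

/-- A perfect (1-error-correcting) code: every vector is within Hamming distance 1 of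
exactly one codeword. -/
def IsPerfect (C : Set (F ι)) : Prop :=
  ∀ x : F ι, ∃! c, c ∈ C ∧ hammingDist x c ≤ 1

/-- `STS(C, y) = {supp (x + y) : x ∈ C, d(x, y) = 3}`. -/
def STS (C : Set (F ι)) (y : F ι) : Set (Set ι) :=
  {s | ∃ x ∈ C, hammingDist x y = 3 ∧ s = supp (x + y)}

/-- A reduced perfect code is homogeneous if each `STS(C,y)`, `y ∈ C`, is isomorphic
to `STS(C, 0)`. -/
def IsHomogeneous (C : Set (F ι)) : Prop :=
  ∀ y ∈ C, ∃ π : Equiv.Perm ι, (Set.image π) '' (STS C y) = STS C (0 : F ι)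

/-- The (mod 2) weight `|x| = x_1 + ⋯ + x_n`. -/
def wt (x : F ι) : ZMod 2 := ∑ i, x i

/-- The scalar product `u · y = Σ u_i y_i (mod 2)`. -/
def dot (u y : F ι) : ZMod 2 := ∑ i, u i * y i

/-- A linear code: a subspace of `F ι` (over `ZMod 2` it suffices to be closed under `+`). -/
def IsLinearCode (C : Set (F ι)) : Prop :=
  (0 : F ι) ∈ C ∧ ∀ x ∈ C, ∀ y ∈ C, x + y ∈ C

/-- A Hamming code: a linear perfect code. -/
def IsHammingCode (C : Set (F ι)) : Prop := IsLinearCode C ∧ IsPerfect C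

/-- The `i`-component `R_i`: the linear span of the weight-3 codewords of `H` whose
support contains `i`. -/
def component (H : Set (F ι)) (i : ι) : Set (F ι) :=
  ↑(Submodule.span (ZMod 2) {x | x ∈ H ∧ hammingNorm x = 3 ∧ x i ≠ 0})

/-- `lam` pierces `R` if it takes both values 0 and 1 on `R`. -/
def Pierces (lam : F ι → ZMod 2) (R : Set (F ι)) : Prop :=
  (∃ x ∈ R, lam x = 0) ∧ (∃ x ∈ R, lam x = 1)

/-- The vector `(a, b, c)` of length `2n+1`: coordinates `1..n` are `a`, coordinate `n+1`
is `b`, coordinates `n+2..2n+1` are `c`. -/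
def vasVec (a : F ι) (b : ZMod 2) (c : F ι) : F (ι ⊕ Unit ⊕ ι) :=
  Sum.elim a (Sum.elim (fun _ => b) c)

/-- The Vasil'ev code `V_C^λ = {(x + y, |x| + λ(y), x) : x ∈ F^n, y ∈ C}`. -/
def Vasiliev (C : Set (F ι)) (lam : F ι → ZMod 2) : Set (F (ι ⊕ Unit ⊕ ι)) :=
  {v | ∃ x : F ι, ∃ y ∈ C, v = vasVec (x + y) (wt x + lam y) x}

/-- The subspace `R_{n+1}^{2n+1} = {(x, |x|, x) : x ∈ F^n}`. -/
def Rmid : Set (F (ι ⊕ Unit ⊕ ι)) := {v | ∃ x : F ι, v = vasVec x (wt x) x}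

/-- Underlying function of `τ_u`: swaps positions `i` and `i + n + 1` for `i ∈ supp u`. -/
def tauFun (u : F ι) : (ι ⊕ Unit ⊕ ι) → (ι ⊕ Unit ⊕ ι)
  | Sum.inl i => if u i ≠ 0 then Sum.inr (Sum.inr i) else Sum.inl i
  | Sum.inr (Sum.inl _) => Sum.inr (Sum.inl ())
  | Sum.inr (Sum.inr i) => if u i ≠ 0 then Sum.inl i else Sum.inr (Sum.inr i)

theorem tauFun_involutive (u : F ι) : Function.Involutive (tauFun u) := by
  intro x
  rcases x with i | x
  · by_cases h : u i = 0 <;> simp [tauFun, h]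
  · rcases x with u' | i
    · simp [tauFun]
    · by_cases h : u i = 0 <;> simp [tauFun, h]

/-- The permutation `τ_u`: the product of transpositions `(i, i+n+1)` over `i ∈ supp u`. -/
def tau (u : F ι) : Equiv.Perm (ι ⊕ Unit ⊕ ι) :=
  Function.Involutive.toPerm (tauFun u) (tauFun_involutive u)

/-- The duplicator `σ_π`: fixes position `n+1`, sends `i ↦ π(i)` and `i+n+1 ↦ π(i)+n+1`. -/
def dup (π : Equiv.Perm ι) : Equiv.Perm (ι ⊕ Unit ⊕ ι) :=
  Equiv.sumCongr π (Equiv.sumCongr (Equiv.refl Unit) π)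

/-- The extension of `λ` one step up the Vasil'ev recursion: `λ'(z) = λ(y)` for
`z ∈ (y, 0^{m+1}) + R_{m+1}^{2m+1}` (well defined by recovering `y` from `z`). -/
def lamSucc (lam : F ι → ZMod 2) : F (ι ⊕ Unit ⊕ ι) → ZMod 2 :=
  fun z => lam (fun i => z (Sum.inl i) + z (Sum.inr (Sum.inr i)))

/-- `T = {y' ∈ H : (y', λ(y'), 0) ∈ Tr(V_H^λ)}`. -/
def Tset (H : Set (F ι)) (lam : F ι → ZMod 2) : Set (F ι) :=
  {y' | y' ∈ H ∧ vasVec y' (lam y') 0 ∈ TrSet (Vasiliev H lam)}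

/-- The Assmus–Mattson Steiner triple system `S^θ` of order `2n+1`. -/
def AM (S : Set (Set ι)) (θ : Set ι → ZMod 2) : Set (Set (ι ⊕ Unit ⊕ ι)) :=
  {T | (∃ i : ι, T = {Sum.inl i, Sum.inr (Sum.inl ()), Sum.inr (Sum.inr i)}) ∨
    (∃ s ∈ S, θ s = 0 ∧
      (T = Sum.inl '' s ∨
        ∃ a ∈ s, T = insert (Sum.inl a) ((fun i => Sum.inr (Sum.inr i)) '' (s \ {a})))) ∨
    (∃ s ∈ S, θ s = 1 ∧
      (T = (fun i => Sum.inr (Sum.inr i)) '' s ∨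
        ∃ a ∈ s, T = insert (Sum.inr (Sum.inr a)) (Sum.inl '' (s \ {a}))))}

end Defs

/-- A Steiner triple system on the point set `α`. -/
def IsSTS {α : Type*} (S : Set (Set α)) : Prop :=
  (∀ s ∈ S, s.ncard = 3) ∧ ∀ i j : α, i ≠ j → ∃! s, s ∈ S ∧ i ∈ s ∧ j ∈ s

/-- The Mollard code (with zero function) of the codes `C` and `D`. -/
def Mollard {t r : Type*} [Fintype t] [Fintype r] (C : Set (F t)) (D : Set (F r)) :
    Set (F ((t × r) ⊕ t ⊕ r)) :=
  {v | ∃ x : F (t × r), ∃ c ∈ C, ∃ d ∈ D,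
    v = Sum.elim x (Sum.elim (fun i => c i + ∑ j, x (i, j)) (fun j => d j + ∑ i, x (i, j)))}

/-- Index types of the iterated Vasil'ev construction: lengths `n`, `2n+1`, `4n+3`, …. -/
def HType (n : ℕ) : ℕ → Type
  | 0 => Fin n
  | s + 1 => HType n s ⊕ Unit ⊕ HType n s

def HType.ft (n : ℕ) : ∀ s, Fintype (HType n s)
  | 0 => inferInstanceAs (Fintype (Fin n))
  | s + 1 =>
      letI := HType.ft n s
      inferInstanceAs (Fintype (HType n s ⊕ Unit ⊕ HType n s))

instance (n s : ℕ) : Fintype (HType n s) := HType.ft n s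

def HType.deq (n : ℕ) : ∀ s, DecidableEq (HType n s)
  | 0 => inferInstanceAs (DecidableEq (Fin n))
  | s + 1 =>
      letI := HType.deq n s
      inferInstanceAs (DecidableEq (HType n s ⊕ Unit ⊕ HType n s))

instance (n s : ℕ) : DecidableEq (HType n s) := HType.deq n s

/-- The iterated Hamming codes `H^n, H^{2n+1} = V_{H^n}^0, H^{4n+3}, …`. -/
def Hcode (n : ℕ) (H : Set (F (Fin n))) : ∀ s, Set (F (HType n s))
  | 0 => H
  | s + 1 => Vasiliev (Hcode n H s) 0

/-- The iterated functions `λ_n = λ`, `λ_{2m+1}` extending `λ_m`. -/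
def lamIter (n : ℕ) (lam : F (Fin n) → ZMod 2) : ∀ s, F (HType n s) → ZMod 2
  | 0 => lam
  | s + 1 => lamSucc (lamIter n lam s)

/-- `C_0 = V_{H^n}^λ`, `C_{s+1} = V_{C_s}^0`. -/
def Ccode (n : ℕ) (H : Set (F (Fin n))) (lam : F (Fin n) → ZMod 2) :
    ∀ s, Set (F (HType n (s + 1)))
  | 0 => Vasiliev H lam
  | s + 1 => Vasiliev (Ccode n H lam s) 0

section HammingGeometry

variable {ι κ : Type*}

theorem supp_injective : Function.Injective (supp : F ι → Set ι) := by
  intro x y h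
  have two : ∀ a b : ZMod 2, (a ≠ 0 ↔ b ≠ 0) → a = b := by decide
  funext i
  exact two _ _ (Set.ext_iff.mp h i)

theorem supp_permAct (π : Equiv.Perm ι) (x : F ι) : supp (permAct π x) = π '' supp x := by
  ext i
  simp [supp, permAct, Equiv.image_eq_preimage_symm]

theorem vec_add_self (x : F ι) : x + x = 0 :=
  funext fun _ => CharTwo.add_self_eq_zero _

theorem vec_add_add_cancel (x y : F ι) : x + y + y = x := by
  rw [add_assoc, vec_add_self, add_zero]

variable [Fintype ι] [DecidableEq ι] [Fintype κ] [DecidableEq κ]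

theorem hammingDist_eq_hammingNorm_add (x y : F ι) : hammingDist x y = hammingNorm (x + y) := by
  rw [hammingDist_eq_hammingNorm, neg_eq_of_add_eq_zero_left (vec_add_self x)]

theorem hammingNorm_permAct (π : Equiv.Perm ι) (x : F ι) :
    hammingNorm (permAct π x) = hammingNorm x := by
  unfold hammingNorm permAct
  refine Finset.card_bij (fun i _ => π.symm i) ?_ ?_ ?_
  · simp
  · simp
  · intro b hb
    exact ⟨π b, by simpa using hb, by simp⟩

/-- A map which pulls the support of `v` back into the support of `w` bounds the weight of `v`
by that of `w`. -/
theorem hammingNorm_le_of_fiber (g : κ → Option ι) (w : F κ) (v : F ι)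
    (h : ∀ i, v i ≠ 0 → ∃ k, g k = some i ∧ w k ≠ 0) : hammingNorm v ≤ hammingNorm w := by
  by_cases hv : v = 0
  · simp [hv]
  obtain ⟨i, hi⟩ := Function.ne_iff.mp hv
  have : Nonempty κ := ⟨(h i hi).choose⟩
  choose! f hf using h
  refine Finset.card_le_card_of_injOn f ?_ ?_
  · intro i hi
    simpa using (hf i (by simpa using hi)).2
  · intro i hi j hj hij
    have h1 := (hf i (by simpa using hi)).1
    have h2 := (hf j (by simpa using hj)).1
    rw [hij, h2] at h1
    exact (Option.some.inj h1).symm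

theorem hammingNorm_le_one_iff (x : F ι) :
    hammingNorm x ≤ 1 ↔ x = 0 ∨ ∃ i, x = Pi.single i 1 := by
  constructor
  · intro h
    have two : ∀ a : ZMod 2, a ≠ 0 → a = 1 := by decide
    by_cases hx : x = 0
    · exact Or.inl hx
    · obtain ⟨i, hi⟩ := Function.ne_iff.mp hx
      refine Or.inr ⟨i, funext fun j => ?_⟩
      by_cases hj : j = i
      · subst hj
        simpa using two _ hi
      · rw [Pi.single_eq_of_ne hj]
        by_contra hne
        exact hj (Finset.card_le_one.mp h j (by simpa using hne) i (by simpa using hi))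
  · rintro (rfl | ⟨i, rfl⟩)
    · simp
    · refine Finset.card_le_one.mpr fun a ha b hb => ?_
      simp only [Finset.mem_filter, Finset.mem_univ, true_and, ne_eq, Pi.single_apply,
        ite_eq_right_iff, one_ne_zero, imp_false, not_not] at ha hb
      rw [ha, hb]

/-- Distinct codewords of a perfect code are at distance at least 3. -/
theorem IsPerfect.eq_of_hammingDist_le_two {C : Set (F ι)} (hC : IsPerfect C) {a b : F ι}
    (ha : a ∈ C) (hb : b ∈ C) (h : hammingDist a b ≤ 2) : a = b := by
  by_contra hab
  obtain ⟨i, hi⟩ := Function.ne_iff.mp hab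
  refine hab ((hC (Function.update a i (b i))).unique ⟨ha, ?_⟩ ⟨hb, ?_⟩)
  · refine Finset.card_le_one.mpr fun j hj k hk => ?_
    have key : ∀ l, Function.update a i (b i) l ≠ a l → l = i := fun l hl => by
      by_contra hne
      exact hl (by simp [hne])
    rw [key j (by simpa using hj), key k (by simpa using hk)]
  · have : hammingDist (Function.update a i (b i)) b < hammingDist a b := by
      refine Finset.card_lt_card (Finset.ssubset_iff_of_subset ?_ |>.mpr ⟨i, ?_, ?_⟩)
      · intro j hj
        by_cases hne : j = i
        · subst hne
          simpa using hi
        · simpa [hne] using hj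
      · simpa using hi
      · simp
    omega

theorem mem_STS_iff (C : Set (F ι)) (y : F ι) (s : Set ι) :
    s ∈ STS C y ↔ ∃ w, hammingNorm w = 3 ∧ w + y ∈ C ∧ s = supp w := by
  constructor
  · rintro ⟨x, hx, hd, rfl⟩
    exact ⟨x + y, by rwa [← hammingDist_eq_hammingNorm_add], by rwa [vec_add_add_cancel], rfl⟩
  · rintro ⟨w, hw, hmem, rfl⟩
    refine ⟨w + y, hmem, ?_, by rw [vec_add_add_cancel]⟩
    rw [hammingDist_eq_hammingNorm_add, vec_add_add_cancel, hw]

theorem image_STS_eq_iff (C : Set (F ι)) (y : F ι) (π : Equiv.Perm ι) :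
    Set.image π '' STS C y = STS C 0 ↔
      ∀ w, hammingNorm w = 3 → (w + y ∈ C ↔ permAct π w ∈ C) := by
  constructor
  · intro h w hw
    have h1 : supp (permAct π w) ∈ Set.image π '' STS C y ↔ w + y ∈ C := by
      rw [supp_permAct, (Set.image_injective.mpr π.injective).mem_set_image, mem_STS_iff]
      constructor
      · rintro ⟨w', -, hmem, he⟩
        rwa [supp_injective he]
      · exact fun hmem => ⟨w, hw, hmem, rfl⟩
    rw [← h1, h, mem_STS_iff]
    constructor
    · rintro ⟨w', -, hmem, he⟩
      rw [supp_injective he]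
      simpa using hmem
    · exact fun hmem => ⟨_, by rw [hammingNorm_permAct, hw], by simpa using hmem, rfl⟩
  · intro h
    ext s
    simp only [Set.mem_image, mem_STS_iff, add_zero]
    constructor
    · rintro ⟨_, ⟨w, hw, hmem, rfl⟩, rfl⟩
      exact ⟨permAct π w, by rw [hammingNorm_permAct, hw], (h w hw).mp hmem,
        (supp_permAct π w).symm⟩
    · rintro ⟨w, hw, hmem, rfl⟩
      have hπ : permAct π (permAct π.symm w) = w := by
        funext i
        simp [permAct]
      have hw' : hammingNorm (permAct π.symm w) = 3 := by rw [hammingNorm_permAct, hw]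
      exact ⟨_, ⟨permAct π.symm w, hw', (h _ hw').mpr (by rwa [hπ]), rfl⟩,
        by rw [← supp_permAct, hπ]⟩

end HammingGeometry

section MollardCode

variable {t r : Type*} [Fintype t] [DecidableEq t] [Fintype r] [DecidableEq r]

/-- The first syndrome `a + p₁(x)` of a vector `(x, a, b)`. -/
def rowSyndrome (v : F ((t × r) ⊕ t ⊕ r)) : F t :=
  fun i => v (Sum.inr (Sum.inl i)) + ∑ j, v (Sum.inl (i, j))

/-- The second syndrome `b + p₂(x)` of a vector `(x, a, b)`. -/
def colSyndrome (v : F ((t × r) ⊕ t ⊕ r)) : F r :=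
  fun j => v (Sum.inr (Sum.inr j)) + ∑ i, v (Sum.inl (i, j))

theorem rowSyndrome_add (v w : F ((t × r) ⊕ t ⊕ r)) :
    rowSyndrome (v + w) = rowSyndrome v + rowSyndrome w := by
  funext i
  simp only [rowSyndrome, Pi.add_apply, Finset.sum_add_distrib]
  abel

theorem colSyndrome_add (v w : F ((t × r) ⊕ t ⊕ r)) :
    colSyndrome (v + w) = colSyndrome v + colSyndrome w := by
  funext i
  simp only [colSyndrome, Pi.add_apply, Finset.sum_add_distrib]
  abel

theorem mem_Mollard_iff (C : Set (F t)) (D : Set (F r)) (v : F ((t × r) ⊕ t ⊕ r)) :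
    v ∈ Mollard C D ↔ rowSyndrome v ∈ C ∧ colSyndrome v ∈ D := by
  constructor
  · rintro ⟨x, c, hc, d, hd, rfl⟩
    constructor
    · convert hc using 1
      funext i
      simp [rowSyndrome, add_assoc, CharTwo.add_self_eq_zero]
    · convert hd using 1
      funext i
      simp [colSyndrome, add_assoc, CharTwo.add_self_eq_zero]
  · rintro ⟨hc, hd⟩
    refine ⟨fun p => v (Sum.inl p), _, hc, _, hd, ?_⟩
    funext k
    rcases k with p | i | j
    · rfl
    · simp [rowSyndrome, add_assoc, CharTwo.add_self_eq_zero]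
    · simp [colSyndrome, add_assoc, CharTwo.add_self_eq_zero]

theorem hammingNorm_rowSyndrome_le (v : F ((t × r) ⊕ t ⊕ r)) :
    hammingNorm (rowSyndrome v) ≤ hammingNorm v := by
  refine hammingNorm_le_of_fiber
    (Sum.elim (fun p => some p.1) (Sum.elim some fun _ => none)) _ _ fun i hi => ?_
  by_contra! hne
  refine hi ?_
  rw [rowSyndrome, hne (Sum.inr (Sum.inl i)) rfl,
    Finset.sum_eq_zero fun j _ => hne (Sum.inl (i, j)) rfl, add_zero]

theorem hammingNorm_colSyndrome_le (v : F ((t × r) ⊕ t ⊕ r)) :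
    hammingNorm (colSyndrome v) ≤ hammingNorm v := by
  refine hammingNorm_le_of_fiber
    (Sum.elim (fun p => some p.2) (Sum.elim (fun _ => none) some)) _ _ fun j hj => ?_
  by_contra! hne
  refine hj ?_
  rw [colSyndrome, hne (Sum.inr (Sum.inr j)) rfl,
    Finset.sum_eq_zero fun i _ => hne (Sum.inl (i, j)) rfl, add_zero]

/-- The error vector of weight at most 1 whose syndromes are two given vectors of weight at
most 1. -/
def mollardError (a : F t) (b : F r) : F ((t × r) ⊕ t ⊕ r) :=
  Sum.elim (fun p => a p.1 * b p.2)
    (Sum.elim (fun i => a i + ∑ j, a i * b j) (fun j => b j + ∑ i, a i * b j))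

theorem rowSyndrome_mollardError (a : F t) (b : F r) : rowSyndrome (mollardError a b) = a := by
  funext i
  simp [rowSyndrome, mollardError, add_assoc, CharTwo.add_self_eq_zero]

theorem colSyndrome_mollardError (a : F t) (b : F r) : colSyndrome (mollardError a b) = b := by
  funext i
  simp [colSyndrome, mollardError, add_assoc, CharTwo.add_self_eq_zero]

theorem hammingNorm_mollardError_le_one {a : F t} {b : F r} (ha : hammingNorm a ≤ 1)
    (hb : hammingNorm b ≤ 1) : hammingNorm (mollardError a b) ≤ 1 := by
  rw [hammingNorm_le_one_iff] at *
  rcases ha with rfl | ⟨i, rfl⟩ <;> rcases hb with rfl | ⟨j, rfl⟩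
  · left
    funext k
    rcases k with p | i | j <;> simp [mollardError]
  · refine Or.inr ⟨Sum.inr (Sum.inr j), funext fun k => ?_⟩
    rcases k with p | k | k <;> simp [mollardError, Pi.single_apply]
  · refine Or.inr ⟨Sum.inr (Sum.inl i), funext fun k => ?_⟩
    rcases k with p | k | k <;> simp [mollardError, Pi.single_apply]
  · refine Or.inr ⟨Sum.inl (i, j), funext fun k => ?_⟩
    rcases k with ⟨k, l⟩ | k | k
    · simp [mollardError, Pi.single_apply, Prod.ext_iff, ite_and]
      grind
    · simp [mollardError, Pi.single_apply, CharTwo.add_self_eq_zero]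
    · simp [mollardError, Pi.single_apply, CharTwo.add_self_eq_zero]

theorem eq_mollardError_of_hammingNorm_le_one {e : F ((t × r) ⊕ t ⊕ r)}
    (he : hammingNorm e ≤ 1) : e = mollardError (rowSyndrome e) (colSyndrome e) := by
  have hx : ∀ i j, e (Sum.inl (i, j)) = rowSyndrome e i * colSyndrome e j := by
    intro i j
    rw [hammingNorm_le_one_iff] at he
    rcases he with rfl | ⟨⟨k, l⟩ | k | k, rfl⟩
    · simp [rowSyndrome]
    · simp [rowSyndrome, colSyndrome, Pi.single_apply, ite_and]
      grind
    · simp [colSyndrome]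
    · simp [rowSyndrome]
  funext k
  rcases k with ⟨i, j⟩ | i | j
  · exact hx i j
  · simp only [mollardError, Sum.elim_inr, Sum.elim_inl, ← hx]
    rw [rowSyndrome, add_assoc, CharTwo.add_self_eq_zero, add_zero]
  · simp only [mollardError, Sum.elim_inr, ← hx]
    rw [colSyndrome, add_assoc, CharTwo.add_self_eq_zero, add_zero]

theorem IsPerfect.mollard {C : Set (F t)} {D : Set (F r)} (hC : IsPerfect C)
    (hD : IsPerfect D) : IsPerfect (Mollard C D) := by
  intro z
  obtain ⟨c, ⟨hc, hcd⟩, hcu⟩ := hC (rowSyndrome z)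
  obtain ⟨d, ⟨hd, hdd⟩, hdu⟩ := hD (colSyndrome z)
  rw [hammingDist_eq_hammingNorm_add] at hcd hdd
  refine ⟨z + mollardError (rowSyndrome z + c) (colSyndrome z + d), ⟨?_, ?_⟩, ?_⟩
  · rw [mem_Mollard_iff, rowSyndrome_add, colSyndrome_add, rowSyndrome_mollardError,
      colSyndrome_mollardError, ← add_assoc, ← add_assoc, vec_add_self,
      vec_add_self, zero_add, zero_add]
    exact ⟨hc, hd⟩
  · rw [hammingDist_eq_hammingNorm_add, ← add_assoc, vec_add_self, zero_add]
    exact hammingNorm_mollardError_le_one hcd hdd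
  · rintro v ⟨hv, hvz⟩
    rw [mem_Mollard_iff] at hv
    rw [hammingDist_eq_hammingNorm_add] at hvz
    have h1 : rowSyndrome v = c := hcu _ ⟨hv.1, by
      rw [hammingDist_eq_hammingNorm_add, ← rowSyndrome_add]
      exact (hammingNorm_rowSyndrome_le _).trans hvz⟩
    have h2 : colSyndrome v = d := hdu _ ⟨hv.2, by
      rw [hammingDist_eq_hammingNorm_add, ← colSyndrome_add]
      exact (hammingNorm_colSyndrome_le _).trans hvz⟩
    rw [← h1, ← h2, ← rowSyndrome_add, ← colSyndrome_add,
      ← eq_mollardError_of_hammingNorm_le_one hvz, ← add_assoc, vec_add_self,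
      zero_add]

/-- The permutation of the coordinates of a Mollard code induced by a permutation of the
coordinates of the first code. -/
def mollardPerm (r : Type*) (π : Equiv.Perm t) : Equiv.Perm ((t × r) ⊕ t ⊕ r) :=
  Equiv.sumCongr (Equiv.prodCongr π (Equiv.refl r)) (Equiv.sumCongr π (Equiv.refl r))

theorem rowSyndrome_permAct (π : Equiv.Perm t) (w : F ((t × r) ⊕ t ⊕ r)) :
    rowSyndrome (permAct (mollardPerm r π) w) = permAct π (rowSyndrome w) := by
  funext i
  simp [rowSyndrome, permAct, mollardPerm]

theorem colSyndrome_permAct (π : Equiv.Perm t) (w : F ((t × r) ⊕ t ⊕ r)) :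
    colSyndrome (permAct (mollardPerm r π) w) = colSyndrome w := by
  funext j
  simpa [colSyndrome, permAct, mollardPerm] using
    Equiv.sum_comp π.symm fun i => w (Sum.inl (i, j))

/-- A permutation carrying the triples of a perfect code at `y` to those at `0` matches all the
codewords at distance at most 3 from `y` with those of weight at most 3. -/
theorem IsPerfect.add_mem_iff_permAct_mem {C : Set (F t)} (hC : IsPerfect C) (h0 : 0 ∈ C)
    {y : F t} (hy : y ∈ C) {π : Equiv.Perm t}
    (hπ : Set.image π '' STS C y = STS C 0) {w : F t} (hw : hammingNorm w ≤ 3) :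
    w + y ∈ C ↔ permAct π w ∈ C := by
  rcases hw.lt_or_eq with hlt | heq
  · have hlt' : hammingNorm w ≤ 2 := by omega
    have hl : w + y ∈ C ↔ w = 0 := by
      refine ⟨fun h => ?_, fun h => by simpa [h] using hy⟩
      refine add_eq_right.mp (hC.eq_of_hammingDist_le_two h hy ?_)
      rwa [hammingDist_eq_hammingNorm_add, vec_add_add_cancel]
    have hr : permAct π w ∈ C ↔ w = 0 := by
      refine ⟨fun h => ?_, fun h => by simpa [h, permAct] using h0⟩
      have := hC.eq_of_hammingDist_le_two h h0 (by
        rwa [hammingDist_zero_right, hammingNorm_permAct])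
      rwa [← hammingNorm_eq_zero, hammingNorm_permAct, hammingNorm_eq_zero] at this
    rw [hl, hr]
  · exact (image_STS_eq_iff C y π).mp hπ w heq

theorem IsLinearCode.add_mem_iff {H : Set (F r)} (hH : IsLinearCode H) {x y : F r}
    (hy : y ∈ H) : x + y ∈ H ↔ x ∈ H :=
  ⟨fun h => by simpa only [vec_add_add_cancel] using hH.2 _ h _ hy, fun h => hH.2 _ h _ hy⟩

theorem IsHomogeneous.mollard {C : Set (F t)} {H : Set (F r)} (hhom : IsHomogeneous C)
    (h0 : 0 ∈ C) (hC : IsPerfect C) (hH : IsLinearCode H) : IsHomogeneous (Mollard C H) := by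
  intro y hy
  rw [mem_Mollard_iff] at hy
  obtain ⟨π, hπ⟩ := hhom _ hy.1
  refine ⟨mollardPerm r π, (image_STS_eq_iff _ _ _).mpr fun w hw => ?_⟩
  rw [mem_Mollard_iff, mem_Mollard_iff, rowSyndrome_add, colSyndrome_add, rowSyndrome_permAct,
    colSyndrome_permAct, hH.add_mem_iff hy.2,
    hC.add_mem_iff_permAct_mem h0 hy.1 hπ ((hammingNorm_rowSyndrome_le w).trans hw.le)]

end MollardCode

/-- the Mollard code (with zero function) of a homogeneous perfect code and
a Hamming code is a homogeneous perfect code. -/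
theorem stmt6 {t r : ℕ} (C : Set (F (Fin t))) (h0 : (0 : F (Fin t)) ∈ C)
    (hC : IsPerfect C) (hhom : IsHomogeneous C)
    (H : Set (F (Fin r))) (hH : IsHammingCode H) :
    IsPerfect (Mollard C H) ∧ IsHomogeneous (Mollard C H) := by
  exact ⟨hC.mollard hH.2, hhom.mollard h0 hC hH.1⟩
end

section
/- For every reduced binary code C of length n, Sym(C) ⊆ Rot(C) ⊆ Sym(Ker(C)). -/
set_option linter.unusedSectionVars false

section Helpers

variable {ι : Type*}

theorem permAct_add (π : Equiv.Perm ι) (x y : F ι) :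
    permAct π (x + y) = permAct π x + permAct π y := rfl

theorem permAct_injective (π : Equiv.Perm ι) : Function.Injective (permAct π) :=
  π.symm.surjective.injective_comp_right

theorem permAct_surjective (π : Equiv.Perm ι) : Function.Surjective (permAct π) :=
  π.symm.injective.surjective_comp_right

theorem translateCode_zero (C : Set (F ι)) : translateCode 0 C = C := by
  simp [translateCode]

theorem translateCode_injective (y : F ι) : Function.Injective (translateCode y) :=
  Set.image_injective.mpr (add_right_injective y)

theorem permCode_injective (π : Equiv.Perm ι) : Function.Injective (permCode π) :=
  Set.image_injective.mpr (permAct_injective π)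

theorem translateCode_comm (x y : F ι) (C : Set (F ι)) :
    translateCode x (translateCode y C) = translateCode y (translateCode x C) := by
  simp only [translateCode, Set.image_image, add_left_comm]

theorem permCode_translateCode (π : Equiv.Perm ι) (x : F ι) (C : Set (F ι)) :
    permCode π (translateCode x C) = translateCode (permAct π x) (permCode π C) := by
  simp only [permCode, translateCode, Set.image_image, permAct_add]

theorem mem_KerSet_iff {C : Set (F ι)} (h0 : (0 : F ι) ∈ C) {x : F ι} :
    x ∈ KerSet C ↔ translateCode x C = C := by
  refine ⟨fun h => h.2, fun h => ⟨?_, h⟩⟩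
  rw [← h]
  exact ⟨0, h0, add_zero x⟩

/-- An automorphism `(y, π)` of a reduced code acts on the kernel through `π`. -/
theorem permAct_mem_KerSet_iff {C : Set (F ι)} (h0 : (0 : F ι) ∈ C) {y : F ι}
    {π : Equiv.Perm ι} (hπ : translateCode y (permCode π C) = C) {x : F ι} :
    permAct π x ∈ KerSet C ↔ x ∈ KerSet C := by
  have key : translateCode (permAct π x) C = translateCode y (permCode π (translateCode x C)) := by
    rw [permCode_translateCode, translateCode_comm, hπ]
  rw [mem_KerSet_iff h0, mem_KerSet_iff h0, key]
  conv_lhs => rhs; rw [← hπ]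
  rw [(translateCode_injective y).eq_iff, (permCode_injective π).eq_iff]

end Helpers

/-- `Sym(C) ⊆ Rot(C) ⊆ Sym(Ker(C))`. -/
theorem stmt7 {n : ℕ} (C : Set (F (Fin n))) (h0 : (0 : F (Fin n)) ∈ C) :
    SymSet C ⊆ RotSet C ∧ RotSet C ⊆ SymSet (KerSet C) := by
  refine ⟨fun π hπ => ⟨0, h0, (translateCode_zero _).trans hπ⟩, ?_⟩
  rintro π ⟨y, -, hπ⟩
  have hker : permAct π ⁻¹' KerSet C = KerSet C :=
    Set.ext fun _ => permAct_mem_KerSet_iff h0 hπ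
  change permAct π '' KerSet C = KerSet C
  nth_rw 1 [← hker]
  exact Set.image_preimage_eq _ (permAct_surjective π)
end

section
/- The perfect codes V22^1 and V3^11 of length 15 are not transitive. -/
set_option linter.unusedSectionVars false

/-- Characteristic vector of a finite set of coordinates. -/
def chi (s : Finset (Fin 7)) : F (Fin 7) := fun i => if i ∈ s then 1 else 0

/-- The Hamming code of length 7 spanned by the vectors with supports
`{1,2,3}, {1,4,5}, {1,6,7}, {2,4,6}` (in 0-indexed form `{0,1,2}, {0,3,4}, {0,5,6}, {1,3,5}`). -/
def H7 : Set (F (Fin 7)) :=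
  ↑(Submodule.span (ZMod 2)
      ({chi {0, 1, 2}, chi {0, 3, 4}, chi {0, 5, 6}, chi {1, 3, 5}} : Set (F (Fin 7))))

/-- The function `λ` of the code `V22^1`: `0` exactly on the codewords with supports
`∅, {1,6,7}, {1,3,5,7}, {1,…,7}` (0-indexed: `∅, {0,5,6}, {0,2,4,6}, {0,…,6}`). -/
def lamV22 : F (Fin 7) → ZMod 2 := fun x =>
  if x = chi ∅ ∨ x = chi {0, 5, 6} ∨ x = chi {0, 2, 4, 6} ∨ x = chi {0, 1, 2, 3, 4, 5, 6}
  then 0 else 1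

/-- The function `μ` of the code `V3^11`: `0` exactly on the codewords with supports
`∅, {1,6,7}, {2,4,6}, {4,5,6,7}` (0-indexed: `∅, {0,5,6}, {1,3,5}, {3,4,5,6}`). -/
def lamV3 : F (Fin 7) → ZMod 2 := fun x =>
  if x = chi ∅ ∨ x = chi {0, 5, 6} ∨ x = chi {1, 3, 5} ∨ x = chi {3, 4, 5, 6}
  then 0 else 1

/-- The pairs of codewords of `C` whose sum, shifted by `y`, is again a codeword. -/
def sumClosedPairs {ι : Type*} (C : Set (F ι)) (y : F ι) : Set (F ι × F ι) :=
  {p | p.1 ∈ C ∧ p.2 ∈ C ∧ p.1 + p.2 + y ∈ C}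

theorem add_permAct_mem_iff {ι : Type*} {C : Set (F ι)} {y : F ι} {π : Equiv.Perm ι}
    (h : translateCode y (permCode π C) = C) (u : F ι) : y + permAct π u ∈ C ↔ u ∈ C := by
  constructor
  · intro hu
    rw [← h] at hu
    obtain ⟨_, ⟨v, hv, rfl⟩, hvu⟩ := hu
    have hcomp : v ∘ π.symm = u ∘ π.symm := add_left_cancel hvu
    rwa [← π.symm.surjective.injective_comp_right hcomp]
  · intro hu
    rw [← h]
    exact ⟨_, ⟨u, hu, rfl⟩, rfl⟩

theorem ncard_sumClosedPairs_eq {ι : Type*} {C : Set (F ι)} {y : F ι} {π : Equiv.Perm ι}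
    (h : translateCode y (permCode π C) = C) :
    (sumClosedPairs C 0).ncard = (sumClosedPairs C y).ncard := by
  have hinj : Function.Injective fun u : F ι => y + permAct π u := fun u v huv =>
    π.symm.surjective.injective_comp_right (add_left_cancel huv)
  have hadd : ∀ u v : F ι, (y + permAct π u) + (y + permAct π v) + y = y + permAct π (u + v) := by
    intro u v
    funext i
    simp only [permAct, Pi.add_apply, Function.comp_apply]
    linear_combination CharTwo.add_self_eq_zero (y i)
  rw [← Set.ncard_image_of_injective (sumClosedPairs C 0) (hinj.prodMap hinj)]
  congr 1
  ext ⟨p, q⟩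
  constructor
  · rintro ⟨⟨u, v⟩, ⟨hu, hv, huv⟩, huv'⟩
    obtain ⟨rfl, rfl⟩ := Prod.mk.inj huv'
    refine ⟨(add_permAct_mem_iff h u).2 hu, (add_permAct_mem_iff h v).2 hv, ?_⟩
    change (y + permAct π u) + (y + permAct π v) + y ∈ C
    rw [hadd, add_permAct_mem_iff h]
    simpa using huv
  · rintro ⟨hp, hq, hpq⟩
    have hsurj : ∀ r ∈ C, ∃ u ∈ C, y + permAct π u = r := by
      intro r hr
      rw [← h] at hr
      obtain ⟨_, ⟨u, hu, rfl⟩, hur⟩ := hr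
      exact ⟨u, hu, hur⟩
    obtain ⟨u, hu, rfl⟩ := hsurj p hp
    obtain ⟨v, hv, rfl⟩ := hsurj q hq
    refine ⟨(u, v), ⟨hu, hv, ?_⟩, rfl⟩
    change (y + permAct π u) + (y + permAct π v) + y ∈ C at hpq
    rw [hadd, add_permAct_mem_iff h] at hpq
    simpa using hpq

theorem vasVec_injective {ι : Type*} {a a' c c' : F ι} {b b' : ZMod 2}
    (h : vasVec a b c = vasVec a' b' c') : a = a' ∧ b = b' ∧ c = c' :=
  ⟨funext fun i => congrFun h (Sum.inl i), congrFun h (Sum.inr (Sum.inl ())),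
    funext fun i => congrFun h (Sum.inr (Sum.inr i))⟩

theorem wt_add {ι : Type*} [Fintype ι] (x y : F ι) : wt (x + y) = wt x + wt y :=
  Finset.sum_add_distrib

/-- The codeword of the Vasil'ev code determined by `x ∈ F^n` and `y ∈ C`. -/
def vasWord {ι : Type*} [Fintype ι] (lam : F ι → ZMod 2) (x y : F ι) : F (ι ⊕ Unit ⊕ ι) :=
  vasVec (x + y) (wt x + lam y) x

theorem vasWord_injective {ι : Type*} [Fintype ι] {lam : F ι → ZMod 2} {x x' y y' : F ι}
    (h : vasWord lam x y = vasWord lam x' y') : x = x' ∧ y = y' := by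
  obtain ⟨h₁, -, rfl⟩ := vasVec_injective h
  exact ⟨rfl, add_left_cancel h₁⟩

theorem vasVec_mem_Vasiliev {ι : Type*} [Fintype ι] [DecidableEq ι] {C : Set (F ι)}
    {lam : F ι → ZMod 2} {x y : F ι} {b : ZMod 2} :
    vasVec (x + y) b x ∈ Vasiliev C lam ↔ y ∈ C ∧ b = wt x + lam y := by
  constructor
  · rintro ⟨x', y', hy', h⟩
    obtain ⟨h₁, h₂, rfl⟩ := vasVec_injective h
    obtain rfl := add_left_cancel h₁
    exact ⟨hy', h₂⟩
  · rintro ⟨hy, rfl⟩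
    exact ⟨x, y, hy, rfl⟩

theorem vasWord_add_add {ι : Type*} [Fintype ι] (lam : F ι → ZMod 2) (x x' a b y : F ι) :
    vasWord lam x a + vasWord lam x' b + vasWord lam 0 y =
      vasVec ((x + x') + (a + b + y)) (wt (x + x') + (lam a + lam b + lam y)) (x + x') := by
  have hz : wt (0 : F ι) = 0 := Finset.sum_const_zero
  rw [wt_add]
  funext i
  rcases i with i | i | i <;> simp [vasWord, vasVec, hz] <;> ring

theorem sumClosedPairs_Vasiliev {ι : Type*} [Fintype ι] [DecidableEq ι] {C : Set (F ι)}
    (hC : ∀ a ∈ C, ∀ b ∈ C, a + b ∈ C) (lam : F ι → ZMod 2) {y : F ι} (hy : y ∈ C) :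
    sumClosedPairs (Vasiliev C lam) (vasWord lam 0 y) =
      (fun q : (F ι × F ι) × (F ι × F ι) => (vasWord lam q.1.1 q.2.1, vasWord lam q.1.2 q.2.2)) ''
        (Set.univ ×ˢ {p | p.1 ∈ C ∧ p.2 ∈ C ∧ lam p.1 + lam p.2 + lam y = lam (p.1 + p.2 + y)}) := by
  ext ⟨u, v⟩
  constructor
  · rintro ⟨⟨x, a, ha, rfl⟩, ⟨x', b, hb, rfl⟩, h⟩
    refine ⟨((x, x'), (a, b)), ⟨trivial, ha, hb, ?_⟩, rfl⟩
    change vasWord lam x a + vasWord lam x' b + vasWord lam 0 y ∈ _ at h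
    rw [vasWord_add_add, vasVec_mem_Vasiliev] at h
    exact add_left_cancel h.2
  · rintro ⟨⟨⟨x, x'⟩, ⟨a, b⟩⟩, ⟨-, ha, hb, hab⟩, h⟩
    obtain ⟨rfl, rfl⟩ := Prod.mk.inj h
    refine ⟨⟨x, a, ha, rfl⟩, ⟨x', b, hb, rfl⟩, ?_⟩
    change vasWord lam x a + vasWord lam x' b + vasWord lam 0 y ∈ _
    rw [vasWord_add_add, vasVec_mem_Vasiliev]
    exact ⟨hC _ (hC _ ha _ hb) _ hy, congrArg _ hab⟩

theorem ncard_sumClosedPairs_Vasiliev {ι : Type*} [Fintype ι] [DecidableEq ι] {C : Set (F ι)}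
    (hC : ∀ a ∈ C, ∀ b ∈ C, a + b ∈ C) (lam : F ι → ZMod 2) {y : F ι} (hy : y ∈ C) :
    (sumClosedPairs (Vasiliev C lam) (vasWord lam 0 y)).ncard =
      Nat.card (F ι × F ι) *
        {p : F ι × F ι | p.1 ∈ C ∧ p.2 ∈ C ∧
          lam p.1 + lam p.2 + lam y = lam (p.1 + p.2 + y)}.ncard := by
  rw [sumClosedPairs_Vasiliev hC lam hy, Set.ncard_image_of_injective, Set.ncard_prod,
    Set.ncard_univ]
  rintro ⟨⟨x₁, x₂⟩, ⟨a, b⟩⟩ ⟨⟨x₁', x₂'⟩, ⟨a', b'⟩⟩ h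
  obtain ⟨h₁, h₂⟩ := Prod.mk.inj h
  obtain ⟨rfl, rfl⟩ := vasWord_injective h₁
  obtain ⟨rfl, rfl⟩ := vasWord_injective h₂
  rfl

/-- A transitive Vasil'ev code of a linear code sees the same number of pairs on which `lam` is
additive from every codeword `y`. -/
theorem IsTransitive.ncard_eq {ι : Type*} [Fintype ι] [DecidableEq ι] {C : Set (F ι)}
    {lam : F ι → ZMod 2} (hC : IsLinearCode C) (h0 : lam 0 = 0)
    (h : IsTransitive (Vasiliev C lam)) {y : F ι} (hy : y ∈ C) :
    {p : F ι × F ι | p.1 ∈ C ∧ p.2 ∈ C ∧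
      lam p.1 + lam p.2 + lam 0 = lam (p.1 + p.2 + 0)}.ncard =
    {p : F ι × F ι | p.1 ∈ C ∧ p.2 ∈ C ∧
      lam p.1 + lam p.2 + lam y = lam (p.1 + p.2 + y)}.ncard := by
  obtain ⟨π, hπ⟩ := h (vasWord lam 0 y) ⟨0, y, hy, rfl⟩
  have hz : vasWord lam (0 : F ι) 0 = 0 := by
    funext i
    rcases i with i | i | i <;> simp [vasWord, vasVec, wt, h0]
  have hcard := ncard_sumClosedPairs_eq hπ
  rw [← hz, ncard_sumClosedPairs_Vasiliev hC.2 lam hC.1,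
    ncard_sumClosedPairs_Vasiliev hC.2 lam hy] at hcard
  exact Nat.eq_of_mul_eq_mul_left Nat.card_pos hcard

/-- The codeword of the Hamming code `H7` with given coefficients in its defining basis. -/
def hammingWord (c : Fin 4 → ZMod 2) : F (Fin 7) :=
  fun i => c 0 * chi {0, 1, 2} i + c 1 * chi {0, 3, 4} i + c 2 * chi {0, 5, 6} i
    + c 3 * chi {1, 3, 5} i

theorem hammingWord_injective : Function.Injective hammingWord := by
  intro c d h
  have h2 := congrFun h 2
  have h4 := congrFun h 4
  have h6 := congrFun h 6
  have h1 := congrFun h 1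
  simp [hammingWord, chi] at h1 h2 h4 h6
  funext i
  fin_cases i <;> simp_all

theorem mem_H7_iff {x : F (Fin 7)} : x ∈ H7 ↔ ∃ c, hammingWord c = x := by
  have hrange : ({chi {0, 1, 2}, chi {0, 3, 4}, chi {0, 5, 6}, chi {1, 3, 5}} :
      Set (F (Fin 7))) = Set.range ![chi {0, 1, 2}, chi {0, 3, 4}, chi {0, 5, 6}, chi {1, 3, 5}] := by
    simp only [Matrix.range_cons, Matrix.range_empty, Set.union_empty, Set.singleton_union]
  rw [H7, SetLike.mem_coe, hrange, Submodule.mem_span_range_iff_exists_fun]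
  refine exists_congr fun c => ?_
  have hsum : ∑ i, c i • ![chi {0, 1, 2}, chi {0, 3, 4}, chi {0, 5, 6}, chi {1, 3, 5}] i =
      hammingWord c := by
    funext j
    simp [Fin.sum_univ_four, hammingWord]
  rw [hsum]

theorem isLinearCode_H7 : IsLinearCode H7 :=
  ⟨Submodule.zero_mem _, fun _ hx _ hy => Submodule.add_mem _ hx hy⟩

theorem ncard_pairs_H7 (lam : F (Fin 7) → ZMod 2) (y : F (Fin 7)) :
    {p : F (Fin 7) × F (Fin 7) | p.1 ∈ H7 ∧ p.2 ∈ H7 ∧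
      lam p.1 + lam p.2 + lam y = lam (p.1 + p.2 + y)}.ncard =
    (Finset.univ.filter fun c : (Fin 4 → ZMod 2) × (Fin 4 → ZMod 2) =>
      lam (hammingWord c.1) + lam (hammingWord c.2) + lam y =
        lam (hammingWord c.1 + hammingWord c.2 + y)).card := by
  rw [← Set.ncard_coe_finset,
    ← Set.ncard_image_of_injective _ (hammingWord_injective.prodMap hammingWord_injective)]
  congr 1
  ext ⟨a, b⟩
  simp only [Set.mem_ofPred_eq, mem_H7_iff, Set.mem_image, Finset.coe_filter, Finset.mem_univ,
    true_and, Prod.exists, Prod.map_apply, Prod.mk.injEq]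
  constructor
  · rintro ⟨⟨c, rfl⟩, ⟨d, rfl⟩, h⟩
    exact ⟨c, d, h, rfl, rfl⟩
  · rintro ⟨c, d, h, rfl, rfl⟩
    exact ⟨⟨c, rfl⟩, ⟨d, rfl⟩, h⟩

theorem chi_mem_H7 : chi {0, 1, 2} ∈ H7 :=
  Submodule.subset_span (Set.mem_insert _ _)

/-- STATEMENT 12: the codes `V22^1` and `V3^11` are not transitive. -/
theorem stmt12 :
    ¬ IsTransitive (Vasiliev H7 lamV22) ∧ ¬ IsTransitive (Vasiliev H7 lamV3) := by
  constructor
  · intro h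
    have hcard := h.ncard_eq isLinearCode_H7 (by decide) chi_mem_H7
    rw [ncard_pairs_H7, ncard_pairs_H7] at hcard
    revert hcard
    decide +kernel
  · intro h
    have hcard := h.ncard_eq isLinearCode_H7 (by decide) chi_mem_H7
    rw [ncard_pairs_H7, ncard_pairs_H7] at hcard
    revert hcard
    decide +kernel
end
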